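/- Let A be a discrete 1-form and Φ an r-form (r = 0, 1 or 2) on the combinatorial N×M torus such that both d_A^cΦ and δ_A^cΦ are su(2)-valued. Then (Δ_A^cΦ, Φ)_V is a nonnegative real number, and (Δ_A^cΦ, Φ)_V = 0 if and only if Δ_A^cΦ = 0, where Δ_A^c = d_A^c δ_A^c + δ_A^c d_A^c. -/

import Mathlib

open Matrix BigOperators

noncomputable section

/-- 2×2 complex matrices. -/
abbrev Mat : Type := Matrix (Fin 2) (Fin 2) ℂ

/-- A discrete 0-form on the combinatorial N×M torus. -/
abbrev Form0 (N M : ℕ) : Type := ZMod N → ZMod M → Mat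
/-- A discrete 1-form (pair of component families). -/
abbrev Form1 (N M : ℕ) : Type := Form0 N M × Form0 N M
/-- A discrete 2-form. -/
abbrev Form2 (N M : ℕ) : Type := ZMod N → ZMod M → Mat

variable {N M : ℕ}

/-- Coboundary on 0-forms. -/
def d0 (Φ : Form0 N M) : Form1 N M :=
  (fun k s => Φ (k + 1) s - Φ k s, fun k s => Φ k (s + 1) - Φ k s)

/-- Coboundary on 1-forms. -/
def d1 (Ω : Form1 N M) : Form2 N M :=
  fun k s => Ω.2 (k + 1) s - Ω.2 k s - Ω.1 k (s + 1) + Ω.1 k s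

/-- Cup product of two 0-forms. -/
def cup00 (Φ Ψ : Form0 N M) : Form0 N M := fun k s => Φ k s * Ψ k s

/-- Cup product of a 0-form and a 1-form. -/
def cup01 (Φ : Form0 N M) (Ω : Form1 N M) : Form1 N M :=
  (fun k s => Φ k s * Ω.1 k s, fun k s => Φ k s * Ω.2 k s)

/-- Cup product of a 1-form and a 0-form. -/
def cup10 (Ω : Form1 N M) (Φ : Form0 N M) : Form1 N M :=
  (fun k s => Ω.1 k s * Φ (k + 1) s, fun k s => Ω.2 k s * Φ k (s + 1))

/-- Cup product of a 0-form and a 2-form. -/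
def cup02 (Φ : Form0 N M) (Ψ : Form2 N M) : Form2 N M := fun k s => Φ k s * Ψ k s

/-- Cup product of a 2-form and a 0-form. -/
def cup20 (Ψ : Form2 N M) (Φ : Form0 N M) : Form2 N M :=
  fun k s => Ψ k s * Φ (k + 1) (s + 1)

/-- Cup product of two 1-forms. -/
def cup11 (Ω Θ : Form1 N M) : Form2 N M :=
  fun k s => Ω.1 k s * Θ.2 (k + 1) s - Ω.2 k s * Θ.1 k (s + 1)

/-- Star operator on 0-forms. -/
def star0 (Φ : Form0 N M) : Form2 N M := fun k s => Φ k s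

/-- Star operator on 1-forms. -/
def star1 (Ω : Form1 N M) : Form1 N M :=
  (fun k s => -Ω.2 k (s - 1), fun k s => Ω.1 (k - 1) s)

/-- Star operator on 2-forms. -/
def star2 (Ψ : Form2 N M) : Form0 N M := fun k s => Ψ (k - 1) (s - 1)

/-- Inverse star, taking 0-forms to 2-forms (inverse of `star2`). -/
def starInv0 (Φ : Form0 N M) : Form2 N M := fun k s => Φ (k + 1) (s + 1)

/-- Inverse star on 1-forms (inverse of `star1`). -/
def starInv1 (Ω : Form1 N M) : Form1 N M :=
  (fun k s => Ω.2 (k + 1) s, fun k s => -Ω.1 k (s + 1))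

/-- Inverse star, taking 2-forms to 0-forms (inverse of `star0`). -/
def starInv2 (Ψ : Form2 N M) : Form0 N M := fun k s => Ψ k s

/-- Codifferential on 1-forms. -/
def delta1 (Ω : Form1 N M) : Form0 N M :=
  fun k s => Ω.1 (k - 1) s - Ω.1 k s + Ω.2 k (s - 1) - Ω.2 k s

/-- Codifferential on 2-forms. -/
def delta2 (Ψ : Form2 N M) : Form1 N M :=
  (fun k s => Ψ k s - Ψ k (s - 1), fun k s => -(Ψ k s - Ψ (k - 1) s))

/-- Covariant exterior derivative on 0-forms: `d_A Φ = dΦ + A∪Φ − Φ∪A`. -/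
def dA0 (A : Form1 N M) (Φ : Form0 N M) : Form1 N M :=
  d0 Φ + cup10 A Φ - cup01 Φ A

/-- Covariant exterior derivative on 1-forms: `d_A Ω = dΩ + A∪Ω + Ω∪A`. -/
def dA1 (A : Form1 N M) (Ω : Form1 N M) : Form2 N M :=
  d1 Ω + cup11 A Ω + cup11 Ω A

/-- Adjoint covariant derivative on 1-forms:
`δ_A Ω = δΩ + ∗⁻¹(∗Ω ∪ ∗∗A − A ∪ ∗Ω)`. -/
def deltaA1 (A : Form1 N M) (Ω : Form1 N M) : Form0 N M :=
  delta1 Ω + starInv2 (cup11 (star1 Ω) (star1 (star1 A)) - cup11 A (star1 Ω))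

/-- Adjoint covariant derivative on 2-forms:
`δ_A Ψ = δΨ + ∗⁻¹(∗Ψ ∪ ∗∗A + A ∪ ∗Ψ)`. -/
def deltaA2 (A : Form1 N M) (Ψ : Form2 N M) : Form1 N M :=
  delta2 Ψ + starInv1 (cup01 (star2 Ψ) (star1 (star1 A)) + cup10 A (star2 Ψ))

/-- Covariant Laplacian on 0-forms (`δ_A` vanishes on 0-forms). -/
def lapA0 (A : Form1 N M) (Φ : Form0 N M) : Form0 N M := deltaA1 A (dA0 A Φ)

/-- Covariant Laplacian on 1-forms. -/
def lapA1 (A : Form1 N M) (Ω : Form1 N M) : Form1 N M :=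
  dA0 A (deltaA1 A Ω) + deltaA2 A (dA1 A Ω)

/-- Covariant Laplacian on 2-forms (`d_A` of a 2-form is a 3-form, hence zero). -/
def lapA2 (A : Form1 N M) (Ψ : Form2 N M) : Form2 N M := dA1 A (deltaA2 A Ψ)

/-- Discrete curvature of a 1-form `A`. -/
def curv (A : Form1 N M) : Form2 N M :=
  fun k s => A.2 (k + 1) s - A.2 k s - A.1 k (s + 1) + A.1 k s
    + A.1 k s * A.2 (k + 1) s - A.2 k s * A.1 k (s + 1)

/-- Inner product of 0-forms over the torus. -/
def inner0 [NeZero N] [NeZero M] (Φ Ω : Form0 N M) : ℂ :=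
  -(1 / 2) * ∑ k : ZMod N, ∑ s : ZMod M, Matrix.trace (Φ k s * Ω k s)

/-- Inner product of 1-forms over the torus. -/
def inner1 [NeZero N] [NeZero M] (Φ Ω : Form1 N M) : ℂ :=
  -(1 / 2) * ∑ k : ZMod N, ∑ s : ZMod M,
    Matrix.trace (Φ.1 k s * Ω.1 k s + Φ.2 k s * Ω.2 k s)

/-- Inner product of 2-forms over the torus. -/
def inner2 [NeZero N] [NeZero M] (Φ Ω : Form2 N M) : ℂ :=
  -(1 / 2) * ∑ k : ZMod N, ∑ s : ZMod M, Matrix.trace (Φ k s * Ω k s)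

/-- Pairing of a 2-form with the fundamental chain `V`: `⟨V,Ψ⟩ = Σ Ψ_{k,s}`. -/
def pairV [NeZero N] [NeZero M] (Ψ : Form2 N M) : Mat :=
  ∑ k : ZMod N, ∑ s : ZMod M, Ψ k s

/-- A matrix lies in su(2): traceless and skew-Hermitian. -/
def IsSU2 (X : Mat) : Prop := Matrix.trace X = 0 ∧ Xᴴ = -X

/-- An su(2)-valued 0-form (or 2-form). -/
def IsSU2Form0 (Φ : Form0 N M) : Prop := ∀ k s, IsSU2 (Φ k s)

/-- An su(2)-valued 1-form. -/
def IsSU2Form1 (Ω : Form1 N M) : Prop := ∀ k s, IsSU2 (Ω.1 k s) ∧ IsSU2 (Ω.2 k s)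

open scoped ComplexOrder

/-- Summation by parts on the torus: two families differing by a discrete divergence have the
same sum. -/
lemma sum_eq_of_sub_eq_divergence [NeZero N] [NeZero M] (F G P Q : ZMod N → ZMod M → ℂ)
    (h : ∀ k s, F k s - G k s = (P (k + 1) s - P k s) + (Q k (s + 1) - Q k s)) :
    ∑ k, ∑ s, F k s = ∑ k, ∑ s, G k s := by
  rw [← sub_eq_zero, ← Finset.sum_sub_distrib]
  simp_rw [← Finset.sum_sub_distrib, h, Finset.sum_add_distrib, Finset.sum_sub_distrib]
  have hP : ∑ k, ∑ s, P (k + 1) s = ∑ k, ∑ s, P k s :=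
    Equiv.sum_comp (Equiv.addRight (1 : ZMod N)) fun k => ∑ s, P k s
  have hQ : ∀ k, ∑ s, Q k (s + 1) = ∑ s, Q k s := fun k =>
    Equiv.sum_comp (Equiv.addRight (1 : ZMod M)) (Q k)
  simp [hP, hQ]

lemma inner0_comm [NeZero N] [NeZero M] (Φ Ψ : Form0 N M) : inner0 Φ Ψ = inner0 Ψ Φ := by
  simp only [inner0, Matrix.trace_mul_comm (Φ _ _)]

lemma inner1_comm [NeZero N] [NeZero M] (Ω Θ : Form1 N M) : inner1 Ω Θ = inner1 Θ Ω := by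
  simp only [inner1, Matrix.trace_add, Matrix.trace_mul_comm (Ω.1 _ _),
    Matrix.trace_mul_comm (Ω.2 _ _)]

lemma inner1_add_left [NeZero N] [NeZero M] (Ω Θ Ξ : Form1 N M) :
    inner1 (Ω + Θ) Ξ = inner1 Ω Ξ + inner1 Θ Ξ := by
  simp only [inner1, Prod.fst_add, Prod.snd_add, Pi.add_apply, add_mul, Matrix.trace_add,
    Finset.sum_add_distrib]
  ring

/-- `δ_A` on 1-forms is adjoint to `d_A` on 0-forms. -/
lemma inner1_dA0_left [NeZero N] [NeZero M] (A Ω : Form1 N M) (Φ : Form0 N M) :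
    inner1 (dA0 A Φ) Ω = inner0 Φ (deltaA1 A Ω) := by
  unfold inner1 inner0
  congr 1
  apply sum_eq_of_sub_eq_divergence _ _
    (fun k s => Matrix.trace (Φ k s * (Ω.1 (k - 1) s + Ω.1 (k - 1) s * A.1 (k - 1) s)))
    (fun k s => Matrix.trace (Φ k s * (Ω.2 k (s - 1) + Ω.2 k (s - 1) * A.2 k (s - 1))))
  intro k s
  simp [dA0, deltaA1, d0, delta1, cup10, cup01, cup11, star1, starInv2, Matrix.trace_fin_two,
    Matrix.mul_apply, Fin.sum_univ_two]
  ring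

/-- `δ_A` on 2-forms is adjoint to `d_A` on 1-forms. -/
lemma inner2_dA1_left [NeZero N] [NeZero M] (A Ω : Form1 N M) (Ψ : Form2 N M) :
    inner2 (dA1 A Ω) Ψ = inner1 Ω (deltaA2 A Ψ) := by
  unfold inner2 inner1
  congr 1
  apply sum_eq_of_sub_eq_divergence _ _
    (fun k s => Matrix.trace (Ω.2 k s * (Ψ (k - 1) s + Ψ (k - 1) s * A.1 (k - 1) s)))
    (fun k s => -Matrix.trace (Ω.1 k s * (Ψ k (s - 1) + Ψ k (s - 1) * A.2 k (s - 1))))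
  intro k s
  simp [dA1, deltaA2, d1, delta2, cup10, cup01, cup11, star1, star2, starInv1,
    Matrix.trace_fin_two, Matrix.mul_apply, Fin.sum_univ_two]
  ring

lemma IsSU2.neg_trace_mul_self {X : Mat} (hX : IsSU2 X) :
    -Matrix.trace (X * X) = Matrix.trace (Xᴴ * X) := by
  rw [hX.2, Matrix.neg_mul, Matrix.trace_neg]

lemma IsSU2.neg_trace_mul_self_nonneg {X : Mat} (hX : IsSU2 X) : 0 ≤ -Matrix.trace (X * X) := by
  rw [hX.neg_trace_mul_self]
  exact (Matrix.posSemidef_conjTranspose_mul_self X).trace_nonneg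

lemma IsSU2.eq_zero_of_neg_trace_mul_self {X : Mat} (hX : IsSU2 X)
    (h : -Matrix.trace (X * X) = 0) : X = 0 := by
  rwa [hX.neg_trace_mul_self, Matrix.trace_conjTranspose_mul_self_eq_zero_iff] at h

lemma inner0_self [NeZero N] [NeZero M] (Φ : Form0 N M) :
    inner0 Φ Φ = (1 / 2) * ∑ k, ∑ s, -Matrix.trace (Φ k s * Φ k s) := by
  simp [inner0]

lemma inner0_self_nonneg [NeZero N] [NeZero M] {Φ : Form0 N M} (hΦ : IsSU2Form0 Φ) :
    0 ≤ inner0 Φ Φ := by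
  rw [inner0_self]
  exact mul_nonneg one_half_pos.le (Finset.sum_nonneg fun k _ => Finset.sum_nonneg fun s _ =>
    (hΦ k s).neg_trace_mul_self_nonneg)

lemma eq_zero_of_inner0_self [NeZero N] [NeZero M] {Φ : Form0 N M} (hΦ : IsSU2Form0 Φ)
    (h : inner0 Φ Φ = 0) : Φ = 0 := by
  rw [inner0_self, mul_eq_zero_iff_left (by norm_num)] at h
  funext k s
  have hnn : ∀ k s, 0 ≤ -Matrix.trace (Φ k s * Φ k s) := fun k s =>
    (hΦ k s).neg_trace_mul_self_nonneg
  have hk := (Finset.sum_eq_zero_iff_of_nonneg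
    fun k _ => Finset.sum_nonneg fun s _ => hnn k s).1 h k (Finset.mem_univ k)
  exact (hΦ k s).eq_zero_of_neg_trace_mul_self
    ((Finset.sum_eq_zero_iff_of_nonneg fun s _ => hnn k s).1 hk s (Finset.mem_univ s))

lemma inner1_eq_inner0_add [NeZero N] [NeZero M] (Ω Θ : Form1 N M) :
    inner1 Ω Θ = inner0 Ω.1 Θ.1 + inner0 Ω.2 Θ.2 := by
  simp only [inner1, inner0, Matrix.trace_add, Finset.sum_add_distrib, mul_add]

lemma inner1_self_nonneg [NeZero N] [NeZero M] {Ω : Form1 N M} (hΩ : IsSU2Form1 Ω) :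
    0 ≤ inner1 Ω Ω := by
  rw [inner1_eq_inner0_add]
  exact add_nonneg (inner0_self_nonneg fun k s => (hΩ k s).1)
    (inner0_self_nonneg fun k s => (hΩ k s).2)

lemma eq_zero_of_inner1_self [NeZero N] [NeZero M] {Ω : Form1 N M} (hΩ : IsSU2Form1 Ω)
    (h : inner1 Ω Ω = 0) : Ω = 0 := by
  have h₁ : IsSU2Form0 Ω.1 := fun k s => (hΩ k s).1
  have h₂ : IsSU2Form0 Ω.2 := fun k s => (hΩ k s).2
  rw [inner1_eq_inner0_add,
    add_eq_zero_iff_of_nonneg (inner0_self_nonneg h₁) (inner0_self_nonneg h₂)] at h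
  exact Prod.ext (eq_zero_of_inner0_self h₁ h.1) (eq_zero_of_inner0_self h₂ h.2)

lemma dA0_zero (A : Form1 N M) : dA0 A 0 = 0 := by
  ext <;> simp [dA0, d0, cup10, cup01]

lemma dA1_zero (A : Form1 N M) : dA1 A 0 = 0 := by
  ext; simp [dA1, d1, cup11]

lemma deltaA1_zero (A : Form1 N M) : deltaA1 A 0 = 0 := by
  ext; simp [deltaA1, delta1, cup11, star1, starInv2]

lemma deltaA2_zero (A : Form1 N M) : deltaA2 A 0 = 0 := by
  ext <;> simp [deltaA2, delta2, cup01, cup10, star1, star2, starInv1]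

lemma inner0_lapA0 [NeZero N] [NeZero M] (A : Form1 N M) (Φ : Form0 N M) :
    inner0 (lapA0 A Φ) Φ = inner1 (dA0 A Φ) (dA0 A Φ) := by
  rw [inner1_dA0_left, inner0_comm, lapA0]

lemma inner1_lapA1 [NeZero N] [NeZero M] (A Ω : Form1 N M) :
    inner1 (lapA1 A Ω) Ω =
      inner0 (deltaA1 A Ω) (deltaA1 A Ω) + inner2 (dA1 A Ω) (dA1 A Ω) := by
  rw [lapA1, inner1_add_left, inner1_dA0_left, inner2_dA1_left, inner1_comm Ω]

lemma inner2_lapA2 [NeZero N] [NeZero M] (A : Form1 N M) (Ψ : Form2 N M) :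
    inner2 (lapA2 A Ψ) Ψ = inner1 (deltaA2 A Ψ) (deltaA2 A Ψ) := by
  rw [lapA2, inner2_dA1_left]

lemma exists_real_nonneg_eq {z : ℂ} (hz : 0 ≤ z) : ∃ c : ℝ, 0 ≤ c ∧ z = (c : ℂ) :=
  ⟨z.re, (Complex.nonneg_iff.1 hz).1, Complex.eq_re_of_ofReal_le hz⟩

/-- if `d_A^cΦ` and `δ_A^cΦ` are su(2)-valued then `(Δ_A^cΦ, Φ)_V` is a
nonnegative real number, vanishing iff `Δ_A^cΦ = 0` (for `r = 0` the form `δ_A^cΦ`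
vanishes and for `r = 2` the form `d_A^cΦ` vanishes, so these conditions are dropped). -/
theorem discrete_covariant_laplacian_nonneg (N M : ℕ) [NeZero N] [NeZero M]
    (A : Form1 N M) :
    (∀ Φ : Form0 N M, IsSU2Form1 (dA0 A Φ) →
      (∃ c : ℝ, 0 ≤ c ∧ inner0 (lapA0 A Φ) Φ = (c : ℂ)) ∧
      (inner0 (lapA0 A Φ) Φ = 0 ↔ lapA0 A Φ = 0)) ∧
    (∀ Ω : Form1 N M, IsSU2Form0 (dA1 A Ω) → IsSU2Form0 (deltaA1 A Ω) →
      (∃ c : ℝ, 0 ≤ c ∧ inner1 (lapA1 A Ω) Ω = (c : ℂ)) ∧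
      (inner1 (lapA1 A Ω) Ω = 0 ↔ lapA1 A Ω = 0)) ∧
    (∀ Ψ : Form2 N M, IsSU2Form1 (deltaA2 A Ψ) →
      (∃ c : ℝ, 0 ≤ c ∧ inner2 (lapA2 A Ψ) Ψ = (c : ℂ)) ∧
      (inner2 (lapA2 A Ψ) Ψ = 0 ↔ lapA2 A Ψ = 0)) := by
  refine ⟨fun Φ hd => ?_, fun Ω hd hδ => ?_, fun Ψ hδ => ?_⟩
  · refine ⟨exists_real_nonneg_eq ?_, fun h => ?_, fun h => by simp [h, inner0]⟩
    · rw [inner0_lapA0]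
      exact inner1_self_nonneg hd
    · rw [inner0_lapA0] at h
      rw [lapA0, eq_zero_of_inner1_self hd h, deltaA1_zero]
  · have hδ_nonneg := inner0_self_nonneg hδ
    have hd_nonneg : 0 ≤ inner2 (dA1 A Ω) (dA1 A Ω) := inner0_self_nonneg hd
    refine ⟨exists_real_nonneg_eq ?_, fun h => ?_, fun h => by simp [h, inner1]⟩
    · rw [inner1_lapA1]
      exact add_nonneg hδ_nonneg hd_nonneg
    · rw [inner1_lapA1, add_eq_zero_iff_of_nonneg hδ_nonneg hd_nonneg] at h
      rw [lapA1, eq_zero_of_inner0_self hδ h.1, eq_zero_of_inner0_self hd h.2, dA0_zero,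
        deltaA2_zero, add_zero]
  · refine ⟨exists_real_nonneg_eq ?_, fun h => ?_, fun h => by simp [h, inner2]⟩
    · rw [inner2_lapA2]
      exact inner1_self_nonneg hδ
    · rw [inner2_lapA2] at h
      rw [lapA2, eq_zero_of_inner1_self hδ h, dA1_zero]
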